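/- Assume p^m > 2. If for every (u,v) ∈ K^* × K the Walsh transform W_F(u,v) lies in {−p^m, 0, p^m, 2p^m}, then F is locally-APN. -/

import Mathlib

lemma aux_cover {K ι : Type*} [Field K] [Fintype K] [DecidableEq K] [Fintype ι] (E : Subfield K) (q : ℕ)
    (hE : Nat.card E = q) (f : K → K) (hf : ∀ y ∈ E, ∀ x, f (y * x) = y * f x)
    (g : ι → K) (hg0 : ∀ i, g i ≠ 0) (hg : ∀ i j, i ≠ j → g i / g j ∉ E) (hfg : ∀ i, f (g i) = 0) :
    Fintype.card ι * (q - 1) + 1 ≤ (Finset.univ.filter (fun x => f x = 0)).card := by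
  classical
  let φ : Option (ι × {y : E // y ≠ 0}) → K := fun o => match o with
    | none => 0
    | some (i, y) => (y.1 : K) * g i
  have hφ : Function.Injective φ := by
    rintro (_ | ⟨i, y⟩) (_ | ⟨j, z⟩) h
    · rfl
    · exfalso
      have h1 : (0 : K) = (z.1 : K) * g j := h
      have := z.2
      rcases mul_eq_zero.1 h1.symm with h | h
      · exact z.2 (by exact_mod_cast h)
      · exact hg0 _ h
    · exfalso
      have h1 : (y.1 : K) * g i = 0 := h
      rcases mul_eq_zero.1 h1 with h | h
      · exact y.2 (by exact_mod_cast h)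
      · exact hg0 _ h
    · have h1 : (y.1 : K) * g i = (z.1 : K) * g j := h
      have hy : (y.1 : K) ≠ 0 := fun h => y.2 (by exact_mod_cast h)
      by_cases hij : i = j
      · subst hij
        have := mul_right_cancel₀ (hg0 i) h1
        have : y = z := by ext; exact this
        rw [this]
      · exfalso
        apply hg i j hij
        have : g i / g j = (z.1 : K) / y.1 := by
          rw [div_eq_div_iff (hg0 j) hy]; rw [mul_comm, h1]
        rw [this]
        exact E.div_mem z.1.2 y.1.2
  have hc : Fintype.card (Option (ι × {y : E // y ≠ 0})) = Fintype.card ι * (q - 1) + 1 := by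
    rw [Fintype.card_option, Fintype.card_prod, Fintype.card_subtype_compl, ← Nat.card_eq_fintype_card (α := E), hE]
    simp
  rw [← hc, ← Finset.card_univ]
  apply Finset.card_le_card_of_injOn φ _ hφ.injOn
  rintro (_ | ⟨i, y⟩) _
  · have := hf 0 E.zero_mem 0
    simp [φ] at this ⊢
    exact this
  · simp [φ, hf _ y.1.2, hfg]

lemma aux_arc {K : Type*} [Field K] [Fintype K] [DecidableEq K] (E : Subfield K) (q d : ℕ)
    (hq : 2 < q) (hE : Nat.card E = q) (hK : Fintype.card K = q ^ 2)
    (hEq : ∀ y : K, y ∈ E ↔ y ^ q = y)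
    (T : K →+ K) (hT : ∀ z, T z = z + z ^ q) (hTE : ∀ z, T z ∈ E)
    (hd : ∀ y ∈ E, y ^ d = y)
    (hZ : ∀ u v : K, u ≠ 0 → (Finset.univ.filter (fun x : K => T (u * x ^ d - v * x) = 0)).card + 2 ≤ 3 * q)
    (a b c e : K) (hab : a / b ∉ E) (hac : a / c ∉ E) (hae : a / e ∉ E) (hbc : b / c ∉ E)
    (hbe : b / e ∉ E) (hce : c / e ∉ E) (α β γ δ : K) (hα : α ∈ E) (hβ : β ∈ E) (hγ : γ ∈ E)
    (hδ : δ ∈ E) (h1 : α * a + β * b + γ * c + δ * e = 0)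
    (h2 : α * a ^ d + β * b ^ d + γ * c ^ d + δ * e ^ d = 0) : δ = 0 := by
  classical
  have hsymm : ∀ x y : K, x / y ∉ E → y / x ∉ E := by
    intro x y h h'
    apply h
    have := E.inv_mem h'
    rwa [inv_div] at this
  have hl : ∀ x y : K, x / y ∉ E → x ≠ 0 := by
    rintro x y h rfl; exact h (by simp [E.zero_mem])
  have ha := hl _ _ hab
  have hb := hl _ _ hbc
  have hc := hl _ _ hce
  have he := hl _ _ (hsymm _ _ hce)
  have hTl : ∀ y ∈ E, ∀ z, T (y * z) = y * T z := by
    intro y hy z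
    rw [hT, hT, mul_pow, (hEq y).1 hy]; ring
  by_contra hδ0
  -- pigeonhole
  let Φ : K × K → E × E × E := fun w =>
    (⟨T (w.1 * a ^ d - w.2 * a), hTE _⟩, ⟨T (w.1 * b ^ d - w.2 * b), hTE _⟩,
      ⟨T (w.1 * c ^ d - w.2 * c), hTE _⟩)
  obtain ⟨w, w', hne, hw⟩ := Fintype.exists_ne_map_eq_of_card_lt Φ (by
    rw [Fintype.card_prod, Fintype.card_prod, Fintype.card_prod, ← Nat.card_eq_fintype_card (α := E), hE, hK]
    have : q * (q * q) * 1 < q * (q * q) * q := by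
      apply Nat.mul_lt_mul_of_pos_left
      · omega
      · positivity
    calc _ = q * (q * q) * 1 := by ring
      _ < _ := this
      _ = _ := by ring)
  obtain ⟨u, v⟩ := w
  obtain ⟨u', v'⟩ := w'
  simp only [Φ, Prod.mk.injEq, Subtype.mk.injEq] at hw
  have key : ∀ x : K, T (u * x ^ d - v * x) = T (u' * x ^ d - v' * x) →
      T ((u - u') * x ^ d - (v - v') * x) = 0 := by
    intro x hx
    rw [← sub_eq_zero, ← map_sub] at hx
    rw [← hx]; congr 1; ring
  have ka := key a hw.1
  have kb := key b hw.2.1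
  have kc := key c hw.2.2
  have hne' : u - u' ≠ 0 ∨ v - v' ≠ 0 := by
    by_contra! h
    exact hne (by rw [sub_eq_zero.1 h.1, sub_eq_zero.1 h.2])
  generalize u - u' = U at *
  generalize v - v' = V at *
  have hU : U ≠ 0 := by
    rintro rfl
    have hV : V ≠ 0 := by simpa using hne'
    apply hab
    rw [hEq]
    simp only [zero_mul, zero_sub, map_neg, neg_eq_zero] at ka kb
    rw [hT] at ka kb
    have e1 := eq_neg_of_add_eq_zero_right ka
    have e2 := eq_neg_of_add_eq_zero_right kb
    have : a / b = (V * a) / (V * b) := by field_simp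
    rw [this, div_pow, e1, e2, neg_div_neg_eq]
  have ke : T (U * e ^ d - V * e) = 0 := by
    have : δ * T (U * e ^ d - V * e) = 0 := by
      have e1 : δ * (U * e ^ d - V * e) = - (α * (U * a ^ d - V * a)) - (β * (U * b ^ d - V * b))
          - (γ * (U * c ^ d - V * c)) := by
        linear_combination U * h2 - V * h1
      rw [← hTl _ hδ, e1, map_sub, map_sub, map_neg, hTl _ hα, hTl _ hβ, hTl _ hγ, ka, kb, kc]
      simp
    exact (mul_eq_zero.1 this).resolve_left hδ0
  have := aux_cover E q hE (fun x => T (U * x ^ d - V * x)) (by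
      intro y hy x
      rw [← hTl y hy, mul_pow, hd y hy]; congr 1; ring) ![a, b, c, e]
      (by intro i; fin_cases i <;> simpa)
      (by intro i j hij; fin_cases i <;> fin_cases j <;> first | exact absurd rfl hij | (simp; first | assumption | (apply hsymm; assumption)))
      (by intro i; fin_cases i; exacts [ka, kb, kc, ke])
  have h3 := hZ U V hU
  rw [Fintype.card_fin] at this
  omega

lemma aux_arc3 {K : Type*} [Field K] [Fintype K] [DecidableEq K] (E : Subfield K) (q d : ℕ)
    (hq : 2 < q) (hE : Nat.card E = q) (hK : Fintype.card K = q ^ 2)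
    (h4 : ∀ a b c e : K, a / b ∉ E → a / c ∉ E → a / e ∉ E → b / c ∉ E →
      b / e ∉ E → c / e ∉ E → ∀ α β γ δ : K, α ∈ E → β ∈ E → γ ∈ E →
      δ ∈ E → α * a + β * b + γ * c + δ * e = 0 →
      α * a ^ d + β * b ^ d + γ * c ^ d + δ * e ^ d = 0 → δ = 0)
    (a b c : K) (hab : a / b ∉ E) (hac : a / c ∉ E) (hbc : b / c ∉ E) (α β γ : K) 
    (hα : α ∈ E) (hβ : β ∈ E) (hγ : γ ∈ E) (h1 : α * a + β * b + γ * c = 0)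
    (h2 : α * a ^ d + β * b ^ d + γ * c ^ d = 0) : γ = 0 := by
  classical
  have hsymm : ∀ x y : K, x / y ∉ E → y / x ∉ E := by
    intro x y h h'
    apply h
    have := E.inv_mem h'
    rwa [inv_div] at this
  have hl : ∀ x y : K, x / y ∉ E → x ≠ 0 := by
    rintro x y h rfl; exact h (by simp [E.zero_mem])
  have ha := hl _ _ hab
  have hb := hl _ _ hbc
  have hc := hl _ _ (hsymm _ _ hac)
  obtain ⟨e, he⟩ : ∃ e : K, e / a ∉ E ∧ e / b ∉ E ∧ e / c ∉ E := by
    by_contra! hcon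
    let ψ : Option (Fin 3 × {y : E // y ≠ 0}) → K := fun o => match o with
      | none => 0
      | some (i, y) => (y.1 : K) * ![a, b, c] i
    have hs : Function.Surjective ψ := by
      intro e
      by_cases he0 : e = 0
      · exact ⟨none, he0.symm⟩
      have gen : ∀ i : Fin 3, ![a, b, c] i ≠ 0 → e / ![a, b, c] i ∈ E → ∃ o, ψ o = e := by
        intro i h0 hi
        refine ⟨some (i, ⟨⟨_, hi⟩, ?_⟩), ?_⟩
        · intro h
          have := congrArg Subtype.val h
          exact div_ne_zero he0 h0 this
        · exact div_mul_cancel₀ _ h0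
      by_cases hA : e / a ∈ E
      · exact gen 0 ha hA
      by_cases hB : e / b ∈ E
      · exact gen 1 hb hB
      · exact gen 2 hc (hcon e hA hB)
    have := Fintype.card_le_of_surjective ψ hs
    rw [Fintype.card_option, Fintype.card_prod, Fintype.card_subtype_compl, ← Nat.card_eq_fintype_card (α := E), hE, hK] at this
    simp at this
    obtain ⟨r, rfl⟩ : ∃ r, q = r + 1 := ⟨q - 1, by omega⟩
    simp at this
    nlinarith
  exact h4 a b e c hab (hsymm _ _ he.1) hac (hsymm _ _ he.2.1) hbc he.2.2 α β 0 γ hα hβ E.zero_mem hγ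
    (by linear_combination h1) (by linear_combination h2)

lemma aux_two {K : Type*} [Field K] (E : Subfield K) (d : ℕ)
    (hd : ∀ y ∈ E, y ^ d = y)
    (h4 : ∀ a b c e : K, a / b ∉ E → a / c ∉ E → a / e ∉ E → b / c ∉ E →
      b / e ∉ E → c / e ∉ E → ∀ α β γ δ : K, α ∈ E → β ∈ E → γ ∈ E →
      δ ∈ E → α * a + β * b + γ * c + δ * e = 0 →
      α * a ^ d + β * b ^ d + γ * c ^ d + δ * e ^ d = 0 → δ = 0)
    (h3 : ∀ a b c : K, a / b ∉ E → a / c ∉ E → b / c ∉ E → ∀ α β γ : K, α ∈ E → β ∈ E → γ ∈ E →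
      α * a + β * b + γ * c = 0 → α * a ^ d + β * b ^ d + γ * c ^ d = 0 → γ = 0)
    (x y : K) (hx : x ∉ E) (hy : y ∉ E) (hxy : y ≠ x)
    (h : (x + 1) ^ d - x ^ d = (y + 1) ^ d - y ^ d) : y = - x - 1 := by
  have hsymm : ∀ x y : K, x / y ∉ E → y / x ∉ E := by
    intro x y h h'
    apply h
    have := E.inv_mem h'
    rwa [inv_div] at this
  have h1E := E.one_mem
  have hn1E := E.neg_mem h1E
  -- linear independence of 1, x over E
  have hli : ∀ z : K, z ∉ E → ∀ k ∈ E, ∀ l ∈ E, k * z = l → k = 0 := by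
    intro z hz k hk l hl e
    by_contra h0
    apply hz
    have : z = l / k := by rw [eq_div_iff h0, ← e, mul_comm]
    rw [this]; exact E.div_mem hl hk
  have hne0 : ∀ z : K, z ∉ E → z ≠ 0 ∧ z + 1 ≠ 0 := by
    intro z hz
    refine ⟨fun e => hz (e ▸ E.zero_mem), fun e => hz ?_⟩
    rw [eq_neg_of_add_eq_zero_left e]; exact hn1E
  have hcons : ∀ z : K, z ∉ E → z / (z + 1) ∉ E := by
    intro z hz hk
    set k := z / (z + 1) with hkd
    have e : z = k * (z + 1) := by rw [hkd, div_mul_cancel₀ _ (hne0 z hz).2]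
    have e0 := hli z hz (1 - k) (E.sub_mem h1E hk) k hk (by linear_combination e)
    have e1 : k = 1 := by linear_combination -e0
    rw [e1] at e
    exact one_ne_zero (α := K) (by linear_combination -e)
  obtain ⟨hx0, hx1⟩ := hne0 x hx
  obtain ⟨hy0, hy1⟩ := hne0 y hy
  have cx := hcons x hx
  have cy := hcons y hy
  have trans : ∀ a b c : K, b ≠ 0 → a / b ∈ E → b / c ∈ E → a / c ∈ E := by
    intro a b c hb h1 h2
    have := E.mul_mem h1 h2
    rwa [div_mul_div_cancel₀ hb] at this
  by_cases A : y / x ∈ E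
  · exfalso
    set c := y / x with hc
    have ey : y = c * x := by rw [hc, div_mul_cancel₀ _ hx0]
    have nB : (y + 1) / x ∉ E := by
      intro hB
      apply hsymm _ _ cy
      exact trans _ _ _ hx0 hB (by have := E.inv_mem A; rwa [hc, inv_div] at this)
    by_cases B : (y + 1) / (x + 1) ∈ E
    · set e := (y + 1) / (x + 1) with he
      have ey1 : y + 1 = e * (x + 1) := by rw [he, div_mul_cancel₀ _ hx1]
      have e0 := hli x hx (c - e) (E.sub_mem A B) (e - 1) (E.sub_mem B h1E)
        (by linear_combination ey1 - ey)
      have : e = 1 := by linear_combination x * e0 + ey - ey1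
      rw [this] at ey1
      exact hxy (by linear_combination ey1)
    · have := h3 x (x + 1) (y + 1) cx (hsymm _ _ nB) (hsymm _ _ B) (c - 1) 1 (-1)
        (E.sub_mem A h1E) h1E hn1E (by linear_combination - ey) (by
          have : y ^ d = c * x ^ d := by rw [ey, mul_pow, hd c A]
          linear_combination h - this)
      exact one_ne_zero (α := K) (by linear_combination - this)
  by_cases B : (y + 1) / (x + 1) ∈ E
  · exfalso
    set c := (y + 1) / (x + 1) with hc
    have ey : y + 1 = c * (x + 1) := by rw [hc, div_mul_cancel₀ _ hx1]
    have nB : y / (x + 1) ∉ E := by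
      intro hB
      apply cy
      exact trans _ _ _ hx1 hB (by have := E.inv_mem B; rwa [hc, inv_div] at this)
    have := h3 x (x + 1) y cx (hsymm _ _ A) (hsymm _ _ nB) (-1) (1 - c) 1 
        hn1E (E.sub_mem h1E B) h1E (by linear_combination ey) (by
          have : (y + 1) ^ d = c * (x + 1) ^ d := by rw [ey, mul_pow, hd c B]
          linear_combination h + this)
    exact one_ne_zero (α := K) (by linear_combination this)
  by_cases C : y / (x + 1) ∈ E
  · set c := y / (x + 1) with hc
    have ey : y = c * (x + 1) := by rw [hc, div_mul_cancel₀ _ hx1]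
    by_cases D : (y + 1) / x ∈ E
    · set e := (y + 1) / x with he
      have ey1 : y + 1 = e * x := by rw [he, div_mul_cancel₀ _ hx0]
      have e0 := hli x hx (e - c) (E.sub_mem D C) (c + 1) (E.add_mem C h1E)
        (by linear_combination ey - ey1)
      have : c = -1 := by linear_combination ey1 - ey + x * e0
      rw [this] at ey
      linear_combination ey
    · exfalso
      have := h3 x (x + 1) (y + 1) cx (hsymm _ _ D) (hsymm _ _ B) (-1) (1 + c) (-1)
        hn1E (E.add_mem h1E C) hn1E (by linear_combination - ey) (by
          have : y ^ d = c * (x + 1) ^ d := by rw [ey, mul_pow, hd c C]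
          linear_combination h - this)
      exact one_ne_zero (α := K) (by linear_combination - this)
  exfalso
  by_cases D : (y + 1) / x ∈ E
  · set c := (y + 1) / x with hc
    have ey : y + 1 = c * x := by rw [hc, div_mul_cancel₀ _ hx0]
    have := h3 x (x + 1) y cx (hsymm _ _ A) (hsymm _ _ C) (-1 - c) 1 1
        (E.sub_mem hn1E D) h1E h1E (by linear_combination ey) (by
          have : (y + 1) ^ d = c * x ^ d := by rw [ey, mul_pow, hd c D]
          linear_combination h + this)
    exact one_ne_zero (α := K) (by linear_combination this)
  · have := h4 x (x + 1) (y + 1) y cx (hsymm _ _ D) (hsymm _ _ A) (hsymm _ _ B) (hsymm _ _ C)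
      (hsymm _ _ cy) (-1) 1 (-1) 1 hn1E h1E hn1E h1E (by ring) (by linear_combination h)
    exact one_ne_zero this

lemma aux_one {K : Type*} [Field K] (E : Subfield K) (d : ℕ)
    (h3 : ∀ a b c : K, a / b ∉ E → a / c ∉ E → b / c ∉ E → ∀ α β γ : K, α ∈ E → β ∈ E → γ ∈ E →
      α * a + β * b + γ * c = 0 → α * a ^ d + β * b ^ d + γ * c ^ d = 0 → γ = 0)
    (x : K) (hx : x ∉ E) : (x + 1) ^ d - x ^ d ≠ 1 := by
  intro h
  have h1E := E.one_mem
  have hn1E := E.neg_mem h1E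
  have := h3 x (x + 1) 1 (by
    intro hk
    have hx1 : x + 1 ≠ 0 := fun e => hx (by rw [eq_neg_of_add_eq_zero_left e]; exact hn1E)
    set k := x / (x + 1) with hkd
    have e : x = k * (x + 1) := by rw [hkd, div_mul_cancel₀ _ hx1]
    by_cases h0 : 1 - k = 0
    · have e1 : k = 1 := by linear_combination -h0
      rw [e1] at e
      exact one_ne_zero (α := K) (by linear_combination -e)
    · apply hx
      have : x = k / (1 - k) := by rw [eq_div_iff h0]; linear_combination e
      rw [this]; exact E.div_mem hk (E.sub_mem h1E hk)) (by simpa using hx)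
    (by
      rw [div_one]
      intro h'
      apply hx
      have := E.sub_mem h' h1E
      simpa using this) (-1) 1 (-1) hn1E h1E hn1E (by ring) (by rw [one_pow]; linear_combination h)
  exact one_ne_zero (α := K) (by linear_combination - this)

lemma aux_walsh {K : Type*} [Field K] [Fintype K] [DecidableEq K] (E : Subfield K) (q d : ℕ)
    (hq : 2 < q) (hE : Nat.card E = q) (hK : Fintype.card K = q ^ 2)
    (χ : AddChar K ℂ) (T : K → K) (hχ : ∀ w, T w = 0 → ∀ y ∈ E, χ (y * w) = 1)
    (hd : ∀ y ∈ E, y ^ d = y) (u v : K)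
    (hval : ∑ x : K, χ (u * x ^ d - v * x) ∈ ({-(q : ℂ), 0, (q : ℂ), 2 * (q : ℂ)} : Set ℂ)) :
    (Finset.univ.filter (fun x : K => T (u * x ^ d - v * x) = 0)).card + 2 ≤ 3 * q := by
  classical
  set W := ∑ x : K, χ (u * x ^ d - v * x) with hW
  have hEc : Fintype.card E = q := by rw [← Nat.card_eq_fintype_card, hE]
  let P : K → Prop := fun x => ∀ y : E, χ ((y : K) * (u * x ^ d - v * x)) = 1
  have h1 : ∑ y : E, ∑ x : K, χ ((y : K) * (u * x ^ d - v * x)) = (q : ℂ) ^ 2 + ((q : ℂ) - 1) * W := by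
    rw [← Finset.add_sum_erase _ _ (Finset.mem_univ (0 : E))]
    congr 1
    · simp [hK]
    · have : ∀ y ∈ Finset.univ.erase (0 : E), ∑ x : K, χ ((y : K) * (u * x ^ d - v * x)) = W := by
        intro y hy
        have hy0 : (y : K) ≠ 0 := fun h => (Finset.ne_of_mem_erase hy) (by exact_mod_cast h)
        rw [hW, ← Equiv.sum_comp (Equiv.mulLeft₀ (y : K) hy0) (fun x => χ (u * x ^ d - v * x))]
        apply Finset.sum_congr rfl
        intro x _
        simp only [Equiv.mulLeft₀_apply, mul_pow, hd _ y.2]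
        congr 1; ring
      rw [Finset.sum_congr rfl this, Finset.sum_const, Finset.card_erase_of_mem (Finset.mem_univ _),
        Finset.card_univ, hEc, nsmul_eq_mul, Nat.cast_sub (by omega)]
      simp
  have h2 : ∑ y : E, ∑ x : K, χ ((y : K) * (u * x ^ d - v * x)) =
      (q : ℂ) * ((Finset.univ.filter P).card : ℂ) := by
    rw [Finset.sum_comm]
    have : ∀ x : K, ∑ y : E, χ ((y : K) * (u * x ^ d - v * x)) = if P x then (q : ℂ) else 0 := by
      intro x
      let ψ : AddChar E ℂ := χ.compAddMonoidHom
        ((AddMonoidHom.mulRight (u * x ^ d - v * x)).comp E.subtype.toAddMonoidHom)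
      have h := AddChar.sum_eq_ite ψ
      have hψ : ∀ y : E, ψ y = χ ((y : K) * (u * x ^ d - v * x)) := fun y => rfl
      have hP : ψ = 0 ↔ P x := by
        constructor
        · intro h y; rw [← hψ, h]; rfl
        · intro h; ext y; rw [hψ]; exact h y
      simp only [hψ, hP, hEc] at h
      exact h
    simp only [this]
    rw [← Finset.sum_filter, Finset.sum_const, nsmul_eq_mul, mul_comm]
  have hle : (Finset.univ.filter (fun x : K => T (u * x ^ d - v * x) = 0)).card ≤
      (Finset.univ.filter P).card := by
    apply Finset.card_le_card
    intro x hx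
    simp only [Finset.mem_filter, Finset.mem_univ, true_and] at hx ⊢
    exact fun y => hχ _ hx y y.2
  have h3 := h1.symm.trans h2
  generalize (Finset.univ.filter P).card = Z at *
  have hq0 : (q : ℂ) ≠ 0 := by
    have : q ≠ 0 := by omega
    exact_mod_cast this
  simp only [Set.mem_insert_iff, Set.mem_singleton_iff] at hval
  have : Z + 2 ≤ 3 * q := by
    rcases hval with h | h | h | h <;> rw [h] at h3
    · have : (Z : ℂ) = (1 : ℕ) := by
        apply mul_left_cancel₀ hq0; push_cast; linear_combination - h3
      have : Z = 1 := by exact_mod_cast this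
      omega
    · have : (Z : ℂ) = (q : ℕ) := by
        apply mul_left_cancel₀ hq0; linear_combination - h3
      have : Z = q := by exact_mod_cast this
      omega
    · have : ((Z + 1 : ℕ) : ℂ) = (2 * q : ℕ) := by
        apply mul_left_cancel₀ hq0; push_cast; linear_combination - h3
      have : Z + 1 = 2 * q := by exact_mod_cast this
      omega
    · have : ((Z + 2 : ℕ) : ℂ) = (3 * q : ℕ) := by
        apply mul_left_cancel₀ hq0; push_cast; linear_combination - h3
      have : Z + 2 = 3 * q := by exact_mod_cast this
      omega
  omega

open Polynomial in
lemma aux_roots {K : Type*} [Field K] [Fintype K] [DecidableEq K] (q : ℕ) (hq : 1 < q) (c e : K) :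
    (Finset.univ.filter (fun x : K => x ^ q + c * x = e)).card ≤ q := by
  have hdeg : (X ^ q + (C c * X - C e) : K[X]).natDegree = q := by
    have h1 : (C c * X - C e : K[X]).natDegree ≤ 1 := by compute_degree
    rw [natDegree_add_eq_left_of_natDegree_lt]
    · exact natDegree_X_pow q
    · rw [natDegree_X_pow]; omega
  have hne : (X ^ q + (C c * X - C e) : K[X]) ≠ 0 := by
    intro h; rw [h] at hdeg; simp at hdeg; omega
  calc _ ≤ (X ^ q + (C c * X - C e) : K[X]).roots.toFinset.card := by
        apply Finset.card_le_card
        intro x hx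
        simp only [Finset.mem_filter, Finset.mem_univ, true_and] at hx
        simp only [Multiset.mem_toFinset, mem_roots hne, IsRoot.def, eval_add, eval_sub, eval_mul, eval_pow, eval_X, eval_C]
        linear_combination hx
    _ ≤ _ := Multiset.toFinset_card_le _
    _ ≤ _ := (Polynomial.card_roots' _).trans hdeg.le


/-- if `p^m > 2` and the Walsh transform of the Niho power
function `F(x) = x^(s(p^m-1)+1)` over `K = GF(p^(2m))` takes values in
`{-p^m, 0, p^m, 2p^m}` on `K* × K`, then `F` is locally-APN. -/
theorem stmt_11 (p m s : ℕ) [Fact p.Prime] (hm : 0 < m) (hs : 0 < s)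
    (K : Type) [Field K] [Fintype K] [Algebra (ZMod p) K]
    (hK : Fintype.card K = p ^ (2 * m))
    (d : ℕ) (hd : d = s * (p ^ m - 1) + 1)
    (hpm : 2 < p ^ m)
    (W : K → K → ℂ)
    (hW : ∀ u v : K, W u v = ∑ x : K,
      Complex.exp (2 * (Real.pi : ℂ) * Complex.I / (p : ℂ)) ^
        (Algebra.trace (ZMod p) K (u * x ^ d - v * x)).val)
    (hval : ∀ u v : K, u ≠ 0 →
      W u v ∈ ({-(p : ℂ) ^ m, 0, (p : ℂ) ^ m, 2 * (p : ℂ) ^ m} : Set ℂ)) :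
    sSup {k : ℕ | ∃ b : K, b ^ p ≠ b ∧
        Nat.card {x : K // (x + 1) ^ d - x ^ d = b} = k} = 2 := by
  classical
  set q := p ^ m with hqdef
  have hp : p.Prime := Fact.out
  haveI : CharP K p := charP_of_injective_algebraMap (algebraMap (ZMod p) K).injective p
  haveI : ExpChar K p := ExpChar.prime hp
  have hK2 : Fintype.card K = q ^ 2 := by rw [hK, hqdef, ← pow_mul, mul_comm]
  have hpow : ∀ z : K, (z ^ q) ^ q = z := by
    intro z
    rw [← pow_mul, ← sq, ← hK2, FiniteField.pow_card]
  let E : Subfield K := RingHom.eqLocusField (iterateFrobenius K p m) (RingHom.id K)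
  have hEq : ∀ y : K, y ∈ E ↔ y ^ q = y := by
    intro y
    show iterateFrobenius K p m y = y ↔ _
    rw [iterateFrobenius_def]
  let T : K →+ K := AddMonoidHom.id K + (iterateFrobenius K p m).toAddMonoidHom
  have hT : ∀ z, T z = z + z ^ q := by
    intro z
    show z + iterateFrobenius K p m z = _
    rw [iterateFrobenius_def]
  have hTE : ∀ z, T z ∈ E := by
    intro z
    rw [hEq, hT, add_pow_expChar_pow, hpow, add_comm]
  have hEf : Nat.card E = (Finset.univ.filter (fun x : K => x ∈ E)).card := by
    rw [Nat.card_eq_fintype_card, Fintype.card_subtype]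
  have hE : Nat.card E = q := by
    apply le_antisymm
    · rw [hEf]
      refine le_trans (Finset.card_le_card ?_) (aux_roots q (by omega) (-1 : K) 0)
      intro x hx
      simp only [Finset.mem_filter, Finset.mem_univ, true_and] at hx ⊢
      rw [(hEq x).1 hx]; ring
    · have := Finset.card_le_mul_card_image_of_maps_to (f := T) (s := Finset.univ)
        (t := Finset.univ.filter (fun x : K => x ∈ E)) (by
          intro a _; simp [hTE]) q (by
          intro b _
          refine le_trans (Finset.card_le_card ?_) (aux_roots q (by omega) (1 : K) b)
          intro x hx
          simp only [Finset.mem_filter, Finset.mem_univ, true_and] at hx ⊢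
          rw [← hx, hT]; ring)
      rw [Finset.card_univ, hK2, ← hEf, sq] at this
      exact Nat.le_of_mul_le_mul_left this (by omega)
  have hdE : ∀ y ∈ E, y ^ d = y := by
    intro y hy
    by_cases h0 : y = 0
    · subst h0; rw [hd]; simp
    · have : y ^ (q - 1) = 1 := by
        apply mul_right_cancel₀ h0
        rw [← pow_succ, Nat.sub_add_cancel (by omega), (hEq y).1 hy, one_mul]
      rw [hd, pow_succ, mul_comm s, pow_mul, this, one_pow, one_mul]
  have hfin : Module.finrank (ZMod p) K = m + m := by
    have := Module.card_eq_pow_finrank (K := ZMod p) (V := K)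
    rw [hK, ZMod.card] at this
    have := Nat.pow_right_injective hp.two_le this
    omega
  have htr : ∀ w, T w = 0 → Algebra.trace (ZMod p) K w = 0 := by
    intro w hw
    apply (algebraMap (ZMod p) K).injective
    rw [FiniteField.algebraMap_trace_eq_sum_pow, hfin, Finset.sum_range_add, map_zero,
      ← Finset.sum_add_distrib, Nat.card_zmod]
    apply Finset.sum_eq_zero
    intro i _
    rw [pow_add, pow_mul, ← add_pow_expChar_pow, ← hqdef, ← hT, hw, zero_pow]
    exact pow_ne_zero _ hp.ne_zero
  have hTl : ∀ y ∈ E, ∀ z, T (y * z) = y * T z := by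
    intro y hy z
    rw [hT, hT, mul_pow, (hEq y).1 hy]; ring
  have hζ : Complex.exp (2 * (Real.pi : ℂ) * Complex.I / (p : ℂ)) ^ p = 1 :=
    (Complex.isPrimitiveRoot_exp p hp.ne_zero).pow_eq_one
  haveI : NeZero p := ⟨hp.ne_zero⟩
  let χ : AddChar K ℂ := (AddChar.zmodChar p hζ).compAddMonoidHom
    (Algebra.trace (ZMod p) K).toAddMonoidHom
  have hχ : ∀ z, χ z = Complex.exp (2 * (Real.pi : ℂ) * Complex.I / (p : ℂ)) ^
      (Algebra.trace (ZMod p) K z).val := fun z => rfl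
  have hZ : ∀ u v : K, u ≠ 0 →
      (Finset.univ.filter (fun x : K => T (u * x ^ d - v * x) = 0)).card + 2 ≤ 3 * q := by
    intro u v hu
    apply aux_walsh E q d hpm hE hK2 χ T _ hdE u v
    · have := hval u v hu
      rw [hW] at this
      simp only [hχ, hqdef, Nat.cast_pow]
      exact this
    · intro w hw y hy
      rw [hχ, htr _ (by rw [hTl y hy, hw, mul_zero])]
      simp
  have h4 := aux_arc E q d hpm hE hK2 hEq T hT hTE hdE hZ
  have h3 := aux_arc3 E q d hpm hE hK2 h4
  have h2 := aux_two E d hdE h4 h3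
  have h1 := aux_one E d h3
  have hEval : ∀ x ∈ E, (x + 1) ^ d - x ^ d = 1 := by
    intro x hx
    rw [hdE x hx, hdE _ (E.add_mem hx E.one_mem)]; ring
  have hrefl : ∀ x : K, (-x - 1 + 1) ^ d - (-x - 1) ^ d = (x + 1) ^ d - x ^ d := by
    intro x
    have hn := hdE (-1) (E.neg_mem E.one_mem)
    have e1 : -x - 1 + 1 = (-1) * x := by ring
    have e2 : -x - 1 = (-1) * (x + 1) := by ring
    rw [e1, e2, mul_pow, mul_pow, hn]; ring
  have hfix : ∀ x : K, -x - 1 = x → x ∈ E := by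
    intro x hx
    by_cases h2 : (2 : K) = 0
    · exfalso
      exact one_ne_zero (α := K) (by linear_combination - hx - x * h2)
    · have : x = -1 / 2 := by rw [eq_div_iff h2]; linear_combination - hx
      rw [this]
      exact E.div_mem (E.neg_mem E.one_mem) (by
        have := E.add_mem E.one_mem E.one_mem
        rwa [one_add_one_eq_two] at this)
  have hcard : ∀ x : K, x ∉ E → 
      Nat.card {z : K // (z + 1) ^ d - z ^ d = (x + 1) ^ d - x ^ d} = 2 := by
    intro x hx
    rw [Nat.card_eq_fintype_card, Fintype.card_subtype]
    have : (Finset.univ.filter fun z : K => (z + 1) ^ d - z ^ d = (x + 1) ^ d - x ^ d) = {x, -x - 1} := by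
      ext z
      simp only [Finset.mem_filter, Finset.mem_univ, true_and, Finset.mem_insert, Finset.mem_singleton]
      constructor
      · intro hz
        by_cases hzx : z = x
        · exact Or.inl hzx
        right
        have hzE : z ∉ E := by
          intro h
          rw [hEval z h] at hz
          exact h1 x hx hz.symm
        exact h2 x z hx hzE hzx hz.symm
      · rintro (rfl | rfl)
        · rfl
        · exact hrefl x
    rw [this, Finset.card_pair]
    exact fun h => hx (hfix x h.symm)
  have hex : ∃ x : K, x ∉ E ∧ ((x + 1) ^ d - x ^ d) ^ p ≠ (x + 1) ^ d - x ^ d := by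
    by_contra! hcon
    have hle := Finset.card_le_mul_card_image_of_maps_to (f := fun x : K => (x + 1) ^ d - x ^ d)
      (s := Finset.univ.filter (fun x : K => x ∉ E))
      (t := (Finset.univ.filter (fun b : K => b ^ p + (-1) * b = 0)).erase 1) (by
        intro x hx
        simp only [Finset.mem_filter, Finset.mem_univ, true_and] at hx
        simp only [Finset.mem_erase, Finset.mem_filter, Finset.mem_univ, true_and]
        exact ⟨h1 x hx, by rw [hcon x hx]; ring⟩) 2 (by
        intro b _
        by_cases hb : ∃ x, x ∉ E ∧ (x + 1) ^ d - x ^ d = b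
        · obtain ⟨x, hx, rfl⟩ := hb
          rw [← hcard x hx, Nat.card_eq_fintype_card, Fintype.card_subtype]
          apply Finset.card_le_card
          intro z hz
          simp only [Finset.mem_filter, Finset.mem_univ, true_and] at hz ⊢
          exact hz.2
        · rw [Finset.card_eq_zero.2]
          · omega
          · rw [Finset.filter_eq_empty_iff]
            intro x hx hxb
            simp only [Finset.mem_filter, Finset.mem_univ, true_and] at hx
            exact hb ⟨x, hx, hxb⟩)
    rw [Finset.card_erase_of_mem (by simp)] at hle
    have hr := aux_roots p hp.one_lt (-1 : K) 0
    have hsum := Finset.card_filter_add_card_filter_not (s := (Finset.univ : Finset K)) (fun x : K => x ∈ E)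
    rw [← hEf, hE, Finset.card_univ, hK2] at hsum
    have hpq : p ≤ q := Nat.le_self_pow (by omega) p
    have : q ^ 2 ≤ q + 2 * (q - 1) := by omega
    obtain ⟨r, hr⟩ : ∃ r, q = r + 1 := ⟨q - 1, by omega⟩
    rw [hr] at this
    simp at this
    have : 2 ≤ r := by omega
    nlinarith
  apply IsGreatest.csSup_eq
  constructor
  · obtain ⟨x, hx, hb⟩ := hex
    exact ⟨_, hb, hcard x hx⟩
  · rintro k ⟨b, hb, rfl⟩
    by_cases hx : ∃ x, (x + 1) ^ d - x ^ d = b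
    · obtain ⟨x, rfl⟩ := hx
      rw [hcard x]
      intro hxE
      rw [hEval x hxE] at hb
      simp at hb
    · haveI : IsEmpty {x : K // (x + 1) ^ d - x ^ d = b} := ⟨fun z => hx ⟨z.1, z.2⟩⟩
      simp
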